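/- Let D₂ = {(x,y) ∈ ℝ² : x·y = 0} and let K = {(x₁,y₁), …, (x_N, y_N)} ⊆ ℝ² be a finite set. Then the separately convex hull conv_{D₂} K is a finite union of sets of the form I × J, where I is either a singleton {x_i} or a closed interval [x_i, x_j] with endpoints among the first coordinates x₁, …, x_N, and J is either a singleton {y_i} or a closed interval [y_i, y_j] with endpoints among the second coordinates y₁, …, y_N. In particular, conv_{D₂} K is a semialgebraic subset of ℝ² described by finitely many linear polynomials. -/

import Mathlib

/-- A function `f` is `D`-convex if it is convex along every direction in the cone `D`. -/
def DConvex {E : Type*} [AddCommGroup E] [Module ℝ E] (D : Set E) (f : E → ℝ) : Prop :=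
  ∀ A : E, ∀ B ∈ D, ConvexOn ℝ Set.univ (fun t : ℝ => f (A + t • B))

/-- The `D`-convex hull of a set `K`. -/
def DConvexHull {E : Type*} [AddCommGroup E] [Module ℝ E] (D : Set E) (K : Set E) : Set E :=
  {A | ∀ f : E → ℝ, DConvex D f → f A ≤ sSup (f '' K)}

/-- The cone of rank-one directions for diagonal `2×2` matrices, identified with `ℝ²`. -/
def D2 : Set (ℝ × ℝ) := {v | v.1 * v.2 = 0}

/-- Separate convexity, spelled out in coordinates. -/
def SepConv (f : ℝ × ℝ → ℝ) : Prop :=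
  (∀ y, ConvexOn ℝ Set.univ (fun x => f (x, y))) ∧
  (∀ x, ConvexOn ℝ Set.univ (fun y => f (x, y)))

lemma dconvex_iff_sepConv (f : ℝ × ℝ → ℝ) : DConvex D2 f ↔ SepConv f := by
  constructor
  · intro h
    constructor
    · intro y
      have := h (0, y) (1, 0) (by simp [D2])
      simpa using this
    · intro x
      have := h (x, 0) (0, 1) (by simp [D2])
      simpa using this
  · rintro ⟨h1, h2⟩ ⟨x, y⟩ ⟨u, v⟩ huv
    have huv' : u = 0 ∨ v = 0 := by simpa [D2] using huv
    rcases huv' with rfl | rfl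
    · refine ⟨convex_univ, ?_⟩
      intro s _ t _ α β hα hβ hαβ
      have := (h2 x).2 (Set.mem_univ (y + s * v)) (Set.mem_univ (y + t * v)) hα hβ hαβ
      simp only [smul_eq_mul, Prod.smul_mk, Prod.mk_add_mk, mul_zero, add_zero] at this ⊢
      have e : α * (y + s * v) + β * (y + t * v) = y + (α * s + β * t) * v := by
        linear_combination y * hαβ
      rwa [e] at this
    · refine ⟨convex_univ, ?_⟩
      intro s _ t _ α β hα hβ hαβ
      have := (h1 y).2 (Set.mem_univ (x + s * u)) (Set.mem_univ (x + t * u)) hα hβ hαβ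
      simp only [smul_eq_mul, Prod.smul_mk, Prod.mk_add_mk, mul_zero, add_zero] at this ⊢
      have e : α * (x + s * u) + β * (x + t * u) = x + (α * s + β * t) * u := by
        linear_combination x * hαβ
      rwa [e] at this

/-- Membership in the separately convex hull of a finite family. -/
def InHull {N : ℕ} (pts : Fin N → ℝ × ℝ) (A : ℝ × ℝ) : Prop :=
  ∀ f, SepConv f → ∃ i, f A ≤ f (pts i)

lemma mem_hull_iff {N : ℕ} (pts : Fin N → ℝ × ℝ) (A : ℝ × ℝ) :
    A ∈ DConvexHull D2 (Set.range pts) ↔ InHull pts A := by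
  have fin : ∀ f : ℝ × ℝ → ℝ, (f '' Set.range pts).Finite :=
    fun f => (Set.finite_range pts).image f
  constructor
  · intro h f hf
    rcases isEmpty_or_nonempty (Fin N) with hN | hN
    · have := h (fun _ => 1) (by intro _ _ _; exact convexOn_const 1 convex_univ)
      simp only [Set.range_eq_empty, Set.image_empty, Real.sSup_empty] at this
      linarith
    · have hne : (f '' Set.range pts).Nonempty := (Set.range_nonempty pts).image f
      have h1 := hne.csSup_mem (fin f)
      obtain ⟨_, ⟨i, rfl⟩, hi⟩ := h1
      exact ⟨i, hi ▸ h f ((dconvex_iff_sepConv f).2 hf)⟩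
  · intro h f hf
    obtain ⟨i, hi⟩ := h f ((dconvex_iff_sepConv f).1 hf)
    exact hi.trans (le_csSup (fin f).bddAbove ⟨pts i, ⟨i, rfl⟩, rfl⟩)

lemma InHull.swap {N : ℕ} {pts : Fin N → ℝ × ℝ} {A : ℝ × ℝ} (h : InHull pts A) :
    InHull (fun i => (pts i).swap) A.swap := by
  intro f hf
  exact h (fun p => f p.swap) ⟨hf.2, hf.1⟩

lemma three_point {h : ℝ → ℝ} (hh : ConvexOn ℝ Set.univ h) {u v w : ℝ} (huv : u ≤ v)
    (hvw : v ≤ w) : (w - u) * h v ≤ (w - v) * h u + (v - u) * h w := by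
  rcases (huv.trans hvw).eq_or_lt with e | hlt
  · obtain rfl : u = v := le_antisymm huv (e ▸ hvw)
    subst e; simp
  · have hp : 0 < w - u := by linarith
    have := hh.2 (Set.mem_univ u) (Set.mem_univ w)
      (show 0 ≤ (w - v) / (w - u) from div_nonneg (by linarith) hp.le)
      (show 0 ≤ (v - u) / (w - u) from div_nonneg (by linarith) hp.le)
      (by field_simp; ring)
    simp only [smul_eq_mul] at this
    have e : (w - v) / (w - u) * u + (v - u) / (w - u) * w = v := by field_simp; ring
    rw [e] at this
    have h2 := mul_le_mul_of_nonneg_left this hp.le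
    have e2 : (w - u) * ((w - v) / (w - u) * h u + (v - u) / (w - u) * h w)
        = (w - v) * h u + (v - u) * h w := by field_simp
    linarith

/-- Replace `f` on the strip `a < x < b` by linear interpolation in `x`. -/
noncomputable def chordX (a b : ℝ) (f : ℝ × ℝ → ℝ) (p : ℝ × ℝ) : ℝ :=
  open Classical in
  if a < p.1 ∧ p.1 < b then
    ((b - p.1) / (b - a)) * f (a, p.2) + ((p.1 - a) / (b - a)) * f (b, p.2)
  else f p

lemma SepConv.chordX {a b : ℝ} (hab : a < b) {f : ℝ × ℝ → ℝ} (hf : SepConv f) :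
    SepConv (chordX a b f) := by
  have hp : 0 < b - a := by linarith
  constructor
  · intro y
    have e : (fun x => _root_.chordX a b f (x, y)) = (fun x => f (x, y)) ⊔
        (fun x => ((b - x) / (b - a)) * f (a, y) + ((x - a) / (b - a)) * f (b, y)) := by
      funext x
      have e0 : ((b - x) / (b - a)) * f (a, y) + ((x - a) / (b - a)) * f (b, y)
        = ((b - x) * f (a, y) + (x - a) * f (b, y)) / (b - a) := by field_simp
      simp only [_root_.chordX, Pi.sup_apply]
      split_ifs with hx
      · symm
        apply sup_eq_right.2
        rw [e0, le_div_iff₀ hp]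
        have := three_point (hf.1 y) hx.1.le hx.2.le
        linarith
      · symm
        apply sup_eq_left.2
        rw [e0, div_le_iff₀ hp]
        rcases le_or_gt x a with hxa | hxa
        · have := three_point (hf.1 y) hxa hab.le
          linarith
        · have hxb : b ≤ x := by
            by_contra hc
            exact hx ⟨hxa, not_le.1 hc⟩
          have := three_point (hf.1 y) hab.le hxb
          linarith
    rw [e]
    refine (hf.1 y).sup ⟨convex_univ, ?_⟩
    intro s _ t _ α β hα hβ hαβ
    apply le_of_eq
    simp only [smul_eq_mul]
    field_simp
    linear_combination (-(b * f (a, y)) + a * f (b, y)) * hαβ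
  · intro x
    by_cases hx : a < x ∧ x < b
    · have e : (fun y => _root_.chordX a b f (x, y)) =
        (fun y => ((b - x) / (b - a)) • f (a, y)) + (fun y => ((x - a) / (b - a)) • f (b, y)) := by
        funext y; simp [_root_.chordX, hx]
      rw [e]
      exact ((hf.2 a).smul (div_nonneg (by linarith [hx.2]) hp.le)).add
        ((hf.2 b).smul (div_nonneg (by linarith [hx.1]) hp.le))
    · have e : (fun y => _root_.chordX a b f (x, y)) = (fun y => f (x, y)) := by
        funext y; simp only [_root_.chordX, if_neg hx]
      rw [e]; exact hf.2 x

lemma SepConv.sup_const {f : ℝ × ℝ → ℝ} (hf : SepConv f) (M : ℝ) :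
    SepConv (fun p => max (f p) M) :=
  ⟨fun y => (hf.1 y).sup (convexOn_const M convex_univ),
   fun x => (hf.2 x).sup (convexOn_const M convex_univ)⟩

lemma InHull.ne {N : ℕ} {pts : Fin N → ℝ × ℝ} {A : ℝ × ℝ} (h : InHull pts A) :
    Nonempty (Fin N) := by
  obtain ⟨i, _⟩ := h (fun _ => 0) ⟨fun _ => convexOn_const 0 convex_univ,
    fun _ => convexOn_const 0 convex_univ⟩
  exact ⟨i⟩

lemma InHull.endpoints {N : ℕ} {pts : Fin N → ℝ × ℝ} {x y a b : ℝ} (h : InHull pts (x, y))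
    (hax : a < x) (hxb : x < b) (hno : ∀ i, ¬ (a < (pts i).1 ∧ (pts i).1 < b)) :
    InHull pts (a, y) ∧ InHull pts (b, y) := by
  have hp : 0 < b - a := by linarith
  have w1 : 0 < (b - x) / (b - a) := div_pos (by linarith) hp
  have w2 : 0 < (x - a) / (b - a) := div_pos (by linarith) hp
  have w3 : (b - x) / (b - a) + (x - a) / (b - a) = 1 := by field_simp; ring
  have := h.ne
  have key : ∀ f, SepConv f → ∃ i, f (a, y) ≤ f (pts i) ∧ f (b, y) ≤ f (pts i) := by
    intro f hf
    obtain ⟨j, hj⟩ := Finite.exists_max (fun i => f (pts i))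
    obtain ⟨i, hi⟩ := h _ ((hf.sup_const (f (pts j))).chordX (hax.trans hxb))
    refine ⟨j, ?_⟩
    simp only [chordX, hax, hxb, and_self, if_true, if_neg (hno i), max_eq_right (hj i)] at hi
    have m1 := le_max_left (f (a, y)) (f (pts j))
    have m2 := le_max_right (f (a, y)) (f (pts j))
    have m3 := le_max_left (f (b, y)) (f (pts j))
    have m4 := le_max_right (f (b, y)) (f (pts j))
    generalize max (f (a, y)) (f (pts j)) = P at *
    generalize max (f (b, y)) (f (pts j)) = Q at *
    generalize (b - x) / (b - a) = s at *
    generalize (x - a) / (b - a) = t at *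
    generalize f (pts j) = M at *
    have hs : s * (P - M) + t * (Q - M) ≤ 0 := by
      have : s * (P - M) + t * (Q - M) = s * P + t * Q - (s + t) * M := by ring
      rw [this, w3]; linarith
    constructor
    · by_contra hc
      have := mul_pos w1 (show 0 < P - M by linarith)
      have := mul_nonneg w2.le (show 0 ≤ Q - M by linarith)
      linarith
    · by_contra hc
      have := mul_pos w2 (show 0 < Q - M by linarith)
      have := mul_nonneg w1.le (show 0 ≤ P - M by linarith)
      linarith
  exact ⟨fun f hf => (key f hf).imp fun _ h => h.1, fun f hf => (key f hf).imp fun _ h => h.2⟩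

lemma sepConv_lin (s : ℝ) : SepConv (fun p => s * p.1) := by
  refine ⟨fun y => ⟨convex_univ, ?_⟩, fun x => convexOn_const (s * x) convex_univ⟩
  intro u _ v _ α β _ _ _
  apply le_of_eq
  simp only [smul_eq_mul]; ring

lemma InHull.bracket {N : ℕ} {pts : Fin N → ℝ × ℝ} {x y : ℝ} (h : InHull pts (x, y)) :
    ∃ i j, (pts i).1 ≤ x ∧ x ≤ (pts j).1 ∧
      InHull pts ((pts i).1, y) ∧ InHull pts ((pts j).1, y) := by
  by_cases hx : ∃ i, (pts i).1 = x
  · obtain ⟨i, rfl⟩ := hx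
    exact ⟨i, i, le_rfl, le_rfl, h, h⟩
  · push Not at hx
    obtain ⟨j0, hj0⟩ := h _ (sepConv_lin 1)
    obtain ⟨i0, hi0⟩ := h _ (sepConv_lin (-1))
    simp only [one_mul, neg_mul, neg_le_neg_iff] at hi0 hj0
    obtain ⟨i, hi, hi'⟩ := Set.exists_max_image {i | (pts i).1 ≤ x} (fun i => (pts i).1)
      (Set.toFinite _) ⟨i0, hi0⟩
    obtain ⟨j, hj, hj'⟩ := Set.exists_min_image {i | x ≤ (pts i).1} (fun i => (pts i).1)
      (Set.toFinite _) ⟨j0, hj0⟩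
    refine ⟨i, j, hi, hj, h.endpoints (lt_of_le_of_ne hi (hx i))
      (lt_of_le_of_ne hj (hx j).symm) ?_⟩
    rintro k ⟨h1, h2⟩
    rcases le_total (pts k).1 x with hk | hk
    · exact absurd (hi' k hk) (not_le.2 h1)
    · exact absurd (hj' k hk) (not_le.2 h2)

lemma InHull.segment {N : ℕ} {pts : Fin N → ℝ × ℝ} {a b x y : ℝ} (ha : InHull pts (a, y))
    (hb : InHull pts (b, y)) (hax : a ≤ x) (hxb : x ≤ b) : InHull pts (x, y) := by
  intro f hf
  obtain ⟨i, hi⟩ := ha f hf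
  obtain ⟨j, hj⟩ := hb f hf
  have := (hf.1 y).le_max_of_mem_Icc (Set.mem_univ a) (Set.mem_univ b) ⟨hax, hxb⟩
  rcases le_max_iff.1 this with h | h
  · exact ⟨i, h.trans hi⟩
  · exact ⟨j, h.trans hj⟩

lemma InHull.box {N : ℕ} {pts : Fin N → ℝ × ℝ} {A : ℝ × ℝ} (h : InHull pts A) :
    ∃ q : (Fin N × Fin N) × (Fin N × Fin N),
      A ∈ Set.Icc (pts q.1.1).1 (pts q.1.2).1 ×ˢ Set.Icc (pts q.2.1).2 (pts q.2.2).2 ∧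
      ∀ B ∈ Set.Icc (pts q.1.1).1 (pts q.1.2).1 ×ˢ Set.Icc (pts q.2.1).2 (pts q.2.2).2,
        InHull pts B := by
  obtain ⟨x, y⟩ := A
  obtain ⟨k, l, hk, hl, hK, hL⟩ := InHull.bracket (x := y) (y := x) h.swap
  have hK' : InHull pts (x, (pts k).2) := hK.swap
  have hL' : InHull pts (x, (pts l).2) := hL.swap
  obtain ⟨i1, j1, hi1, hj1, hI1, hJ1⟩ := hK'.bracket
  obtain ⟨i2, j2, hi2, hj2, hI2, hJ2⟩ := hL'.bracket
  obtain ⟨i, hi, hIk, hIl⟩ : ∃ i, (pts i).1 ≤ x ∧ InHull pts ((pts i).1, (pts k).2) ∧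
      InHull pts ((pts i).1, (pts l).2) := by
    rcases le_total (pts i1).1 (pts i2).1 with hle | hle
    · exact ⟨i2, hi2, hI1.segment hJ1 hle (hi2.trans hj1), hI2⟩
    · exact ⟨i1, hi1, hI1, hI2.segment hJ2 hle (hi1.trans hj2)⟩
  obtain ⟨j, hj, hJk, hJl⟩ : ∃ j, x ≤ (pts j).1 ∧ InHull pts ((pts j).1, (pts k).2) ∧
      InHull pts ((pts j).1, (pts l).2) := by
    rcases le_total (pts j1).1 (pts j2).1 with hle | hle
    · exact ⟨j1, hj1, hJ1, hI2.segment hJ2 (hi2.trans hj1) hle⟩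
    · exact ⟨j2, hj2, hI1.segment hJ1 (hi1.trans hj2) hle, hJ2⟩
  refine ⟨((i, j), (k, l)), ⟨⟨hi, hj⟩, ⟨hk, hl⟩⟩, ?_⟩
  rintro ⟨u, v⟩ ⟨⟨hu1, hu2⟩, ⟨hv1, hv2⟩⟩
  have c1 := hIk.segment hJk hu1 hu2
  have c2 := hIl.segment hJl hu1 hu2
  exact (InHull.segment c1.swap c2.swap hv1 hv2).swap

lemma InHull.of_compare {N : ℕ} {pts : Fin N → ℝ × ℝ} {A B : ℝ × ℝ} (h : InHull pts A)
    (h1 : ∀ i, compare (B.1 - (pts i).1) 0 = compare (A.1 - (pts i).1) 0)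
    (h2 : ∀ i, compare (B.2 - (pts i).2) 0 = compare (A.2 - (pts i).2) 0) :
    InHull pts B := by
  obtain ⟨q, ⟨⟨ha, hb⟩, ⟨hc, hd⟩⟩, hq⟩ := h.box
  have ge : ∀ u v w : ℝ, compare (u - w) 0 = compare (v - w) 0 → w ≤ v → w ≤ u := by
    intro u v w e hv
    by_contra hc
    rw [compare_lt_iff_lt.2 (by linarith : u - w < 0)] at e
    have := compare_lt_iff_lt.1 e.symm
    linarith
  have le : ∀ u v w : ℝ, compare (u - w) 0 = compare (v - w) 0 → v ≤ w → u ≤ w := by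
    intro u v w e hv
    by_contra hc
    rw [compare_gt_iff_gt.2 (by linarith : u - w > 0)] at e
    have := compare_gt_iff_gt.1 e.symm
    linarith
  exact hq B ⟨⟨ge _ _ _ (h1 _) ha, le _ _ _ (h1 _) hb⟩, ⟨ge _ _ _ (h2 _) hc, le _ _ _ (h2 _) hd⟩⟩

/-- The separately convex hull of a finite planar set `K = {(x₁,y₁),…,(x_N,y_N)}` is a
finite union of products `I × J`, where `I` (resp. `J`) is a singleton `{xᵢ}` or a closed
interval `[xᵢ, xⱼ]` with endpoints among the first (resp. second) coordinates of `K`.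
In particular, it is a semialgebraic set described by finitely many linear polynomials
(i.e. polynomials of total degree at most one). -/
theorem separately_convex_hull_union_of_boxes (N : ℕ) (pts : Fin N → ℝ × ℝ) :
    (∃ (m : ℕ) (I J : Fin m → Set ℝ),
      (∀ k, (∃ i, I k = {(pts i).1}) ∨ ∃ i j, I k = Set.Icc (pts i).1 (pts j).1) ∧
      (∀ k, (∃ i, J k = {(pts i).2}) ∨ ∃ i j, J k = Set.Icc (pts i).2 (pts j).2) ∧
      DConvexHull D2 (Set.range pts) = ⋃ k, I k ×ˢ J k) ∧
    (∃ (m : ℕ) (p : Fin m → MvPolynomial (Fin 2) ℝ),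
      (∀ i, (p i).totalDegree ≤ 1) ∧
      ∃ (M : ℕ) (σ : Fin M → Fin m → Ordering),
        DConvexHull D2 (Set.range pts) =
          ⋃ j, ⋂ i, {v : ℝ × ℝ |
            compare (MvPolynomial.eval ![v.1, v.2] (p i)) 0 = σ j i}) := by
  classical
  constructor
  · let Q := {q : (Fin N × Fin N) × (Fin N × Fin N) //
      ∀ B ∈ Set.Icc (pts q.1.1).1 (pts q.1.2).1 ×ˢ Set.Icc (pts q.2.1).2 (pts q.2.2).2,
        InHull pts B}
    let e := Fintype.equivFin Q
    refine ⟨Fintype.card Q, fun k => Set.Icc (pts (e.symm k).1.1.1).1 (pts (e.symm k).1.1.2).1,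
      fun k => Set.Icc (pts (e.symm k).1.2.1).2 (pts (e.symm k).1.2.2).2,
      fun k => Or.inr ⟨_, _, rfl⟩, fun k => Or.inr ⟨_, _, rfl⟩, ?_⟩
    ext A
    rw [mem_hull_iff, Set.mem_iUnion]
    constructor
    · intro h
      obtain ⟨q, hq, hq'⟩ := h.box
      refine ⟨e ⟨q, hq'⟩, ?_⟩
      beta_reduce
      rw [Equiv.symm_apply_apply]
      exact hq
    · rintro ⟨k, hk⟩
      exact (e.symm k).2 A hk
  · let p0 : Fin N ⊕ Fin N → MvPolynomial (Fin 2) ℝ := Sum.elim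
      (fun i => MvPolynomial.X 0 - MvPolynomial.C (pts i).1)
      (fun i => MvPolynomial.X 1 - MvPolynomial.C (pts i).2)
    let e := Fintype.equivFin (Fin N ⊕ Fin N)
    let p := fun k => p0 (e.symm k)
    let S := {σ : Fin (Fintype.card (Fin N ⊕ Fin N)) → Ordering //
      ∀ v : ℝ × ℝ, (∀ i, compare (MvPolynomial.eval ![v.1, v.2] (p i)) 0 = σ i) → InHull pts v}
    have : Fintype Ordering := ⟨{.lt, .eq, .gt}, by intro x; cases x <;> simp⟩
    let g := Fintype.equivFin S
    refine ⟨_, p, ?_, Fintype.card S, fun j => (g.symm j).1, ?_⟩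
    · intro k
      have : ∀ s, (p0 s).totalDegree ≤ 1 := by
        rintro (i | i) <;>
        · refine (MvPolynomial.totalDegree_sub _ _).trans ?_
          simp [MvPolynomial.totalDegree_X]
      exact this _
    · ext A
      simp only [mem_hull_iff, Set.mem_iUnion, Set.mem_iInter, Set.mem_ofPred_eq]
      constructor
      · intro h
        refine ⟨g ⟨fun i => compare (MvPolynomial.eval ![A.1, A.2] (p i)) 0, ?_⟩, ?_⟩
        · intro B hB
          apply h.of_compare
          · intro i
            have := hB (e (Sum.inl i))
            simpa [p, p0] using this
          · intro i
            have := hB (e (Sum.inr i))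
            simpa [p, p0] using this
        · intro i
          rw [Equiv.symm_apply_apply]
      · rintro ⟨j, hj⟩
        exact (g.symm j).2 A hj
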